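/- arXiv:2010.08734 — 2 statements merged into one kernel-verified Lean document; each statement's English description precedes it below -/
import Mathlib

section
/- Let m ≥ 2 and 1 ≤ s ≤ m be integers, let P = ∑ α_{i₁⋯i_ℓ} X_{i₁}⋯X_{i_ℓ} ∈ 𝔽₂[X₂,…,X_m] be a multilinear polynomial with α_{i₁⋯i_ℓ} = 0 for every index tuple (i₁,…,i_ℓ) with |{j : i_j > s}| ≥ 2, let π : 𝔽₂^m → 𝔽₂^m be the permutation π(x₁,…,x_m) = (x₁ + P(x₂,…,x_m), x₂,…,x_m), and let L = {(0,…,0,x_{s+1},…,x_m) : x_i ∈ 𝔽₂} ⊆ 𝔽₂^m (first s coordinates zero). Then f_{(π,L)} : 𝔽₂^m × 𝔽₂^m → 𝔽₂ is a bent function on 𝔽₂^{2m}. -/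
/-- Dot product on `𝔽₂^m`. -/
def dotp {m : ℕ} (x y : Fin m → ZMod 2) : ZMod 2 := ∑ i, x i * y i

/-- `f : 𝔽₂^m × 𝔽₂^m → 𝔽₂` is bent: every Walsh–Hadamard coefficient is `±2^m`
(the dimension is `t = 2m`, so `2^{t/2} = 2^m`). -/
def IsBent2m {m : ℕ} (f : (Fin m → ZMod 2) × (Fin m → ZMod 2) → ZMod 2) : Prop :=
  ∀ a : (Fin m → ZMod 2) × (Fin m → ZMod 2),
    (∑ z : (Fin m → ZMod 2) × (Fin m → ZMod 2),
        (-1 : ℤ) ^ ((f z + dotp a.1 z.1 + dotp a.2 z.2).val)) = 2 ^ m ∨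
    (∑ z : (Fin m → ZMod 2) × (Fin m → ZMod 2),
        (-1 : ℤ) ^ ((f z + dotp a.1 z.1 + dotp a.2 z.2).val)) = -2 ^ m

/-- Carlet's function `f_{(π,L)}(x,y) = x·π(y) + 1_{L^⊥}(x)`. -/
noncomputable def fpl {m : ℕ} (π : (Fin m → ZMod 2) → (Fin m → ZMod 2))
    (L : Set (Fin m → ZMod 2)) (z : (Fin m → ZMod 2) × (Fin m → ZMod 2)) : ZMod 2 :=
  dotp z.1 (π z.2) +
    ({y : Fin m → ZMod 2 | ∀ x ∈ L, dotp x y = 0}).indicator (fun _ => 1) z.1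

/-- The additive character `a ↦ (-1)^a` of `ℤ/2`, with integer values. -/
def signChar : AddChar (ZMod 2) ℤ where
  toFun a := (-1) ^ a.val
  map_zero_eq_one' := by decide
  map_add_eq_mul' := by decide

theorem signChar_apply (a : ZMod 2) : signChar a = (-1) ^ a.val := rfl

theorem signChar_eq_one_iff (a : ZMod 2) : signChar a = 1 ↔ a = 0 := by
  revert a; simp only [signChar_apply]; decide

theorem signChar_eq_or (a : ZMod 2) : signChar a = 1 ∨ signChar a = -1 := by
  revert a; simp only [signChar_apply]; decide

theorem signChar_mul_self (a : ZMod 2) : signChar a * signChar a = 1 := by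
  revert a; simp only [signChar_apply]; decide

theorem zmod_two_add_add_add : ∀ p q r : ZMod 2, p + (q + r) = p + q + (p + r) + p := by
  decide

theorem dotp_add_right {m : ℕ} (x y z : Fin m → ZMod 2) :
    dotp x (y + z) = dotp x y + dotp x z := by
  simp [dotp, mul_add, Finset.sum_add_distrib]

theorem dotp_comm {m : ℕ} (x y : Fin m → ZMod 2) : dotp x y = dotp y x := by
  simp [dotp, mul_comm]

theorem dotp_add_left {m : ℕ} (x y z : Fin m → ZMod 2) :
    dotp (x + y) z = dotp x z + dotp y z := by
  simp [dotp, add_mul, Finset.sum_add_distrib]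

theorem dotp_zero_right {m : ℕ} (x : Fin m → ZMod 2) : dotp x 0 = 0 := by
  simp [dotp]

theorem dotp_zero_left {m : ℕ} (x : Fin m → ZMod 2) : dotp 0 x = 0 := by
  simp [dotp]

theorem dotp_single_left {m : ℕ} (j : Fin m) (x : Fin m → ZMod 2) :
    dotp (Pi.single j 1) x = x j := by
  simp [dotp, Pi.single_apply]

theorem eq_zero_of_dotp_eq_zero {m : ℕ} {x : Fin m → ZMod 2} (h : ∀ y, dotp y x = 0) :
    x = 0 :=
  funext fun j => by simpa [dotp_single_left] using h (Pi.single j 1)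

theorem pi_zmod_two_add_self {m : ℕ} (x : Fin m → ZMod 2) : x + x = 0 :=
  funext fun _ => CharTwo.add_self_eq_zero _

open Classical in
/-- An additive `𝔽₂`-valued function on a finite group is either trivial or balanced. -/
theorem sum_signChar_addMonoidHom {G : Type*} [AddCommGroup G] [Fintype G] (h : G →+ ZMod 2) :
    ∑ v, signChar (h v) = if ∀ v, h v = 0 then (Fintype.card G : ℤ) else 0 := by
  have key := AddChar.sum_eq_ite (signChar.compAddMonoidHom h)
  simp only [AddChar.compAddMonoidHom_apply] at key
  rw [key]
  refine if_congr ?_ rfl rfl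
  rw [DFunLike.ext_iff]
  refine forall_congr' fun v => ?_
  simp [signChar_eq_one_iff]

/-- The orthogonal complement of a subgroup for `dotp`. -/
def dotpPerp {m : ℕ} (L : AddSubgroup (Fin m → ZMod 2)) : AddSubgroup (Fin m → ZMod 2) where
  carrier := {y | ∀ x ∈ L, dotp x y = 0}
  zero_mem' _ _ := dotp_zero_right _
  add_mem' {a b} ha hb x hx := by rw [dotp_add_right, ha x hx, hb x hx, add_zero]
  neg_mem' {a} ha x hx := by
    rw [neg_eq_of_add_eq_zero_left (pi_zmod_two_add_self a)]; exact ha x hx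

open Classical in
theorem sum_signChar_dotp_subgroup {m : ℕ} (H : AddSubgroup (Fin m → ZMod 2))
    (u : Fin m → ZMod 2) :
    ∑ x : H, signChar (dotp x u) =
      if ∀ x ∈ H, dotp x u = 0 then (Fintype.card H : ℤ) else 0 := by
  have := sum_signChar_addMonoidHom (G := H)
    { toFun := fun x => dotp x u
      map_zero' := dotp_zero_left u
      map_add' := fun x y => dotp_add_left _ _ u }
  simpa using this

theorem sum_signChar_dotp {m : ℕ} (u : Fin m → ZMod 2) :
    ∑ x, signChar (dotp x u) = if u = 0 then 2 ^ m else 0 := by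
  have := sum_signChar_addMonoidHom
    { toFun := fun x => dotp x u
      map_zero' := dotp_zero_left u
      map_add' := fun x y => dotp_add_left x y u }
  simp only [AddMonoidHom.coe_mk, ZeroHom.coe_mk] at this
  rw [this]
  refine (if_congr ⟨eq_zero_of_dotp_eq_zero, ?_⟩ ?_ rfl)
  · rintro rfl x; exact dotp_zero_right x
  · simp [ZMod.card]

open Classical in
theorem sum_ite_mem_subgroup {G : Type*} [AddCommGroup G] [Fintype G] (H : AddSubgroup G)
    (F : G → ℤ) : ∑ x, (if x ∈ H then F x else 0) = ∑ x : H, F x := by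
  rw [← Finset.sum_filter]
  exact Finset.sum_subtype _ (by simp) F

open Classical in
theorem card_mul_card_dotpPerp {m : ℕ} (L : AddSubgroup (Fin m → ZMod 2))
    (hL : ∀ v, (∀ x ∈ dotpPerp L, dotp x v = 0) → v ∈ L) :
    (Fintype.card (dotpPerp L) : ℤ) * Fintype.card L = 2 ^ m := by
  have h1 : ∑ v : Fin m → ZMod 2, ∑ x : dotpPerp L, signChar (dotp x v) =
      (Fintype.card (dotpPerp L) : ℤ) * Fintype.card L := by
    have : ∀ v, ∑ x : dotpPerp L, signChar (dotp x v) =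
        if v ∈ L then (Fintype.card (dotpPerp L) : ℤ) else 0 := fun v => by
      rw [sum_signChar_dotp_subgroup]
      exact if_congr ⟨hL v, fun hv x hx => by rw [dotp_comm]; exact hx v hv⟩ rfl rfl
    simp_rw [this]
    rw [sum_ite_mem_subgroup]
    simp [mul_comm]
  rw [← h1, Finset.sum_comm]
  simp_rw [fun v (x : dotpPerp L) => dotp_comm (x : Fin m → ZMod 2) v, sum_signChar_dotp]
  simp

open Classical in
theorem isBent2m_fpl {m : ℕ} (π : (Fin m → ZMod 2) → (Fin m → ZMod 2))
    (hπ : Function.Involutive π) (L : AddSubgroup (Fin m → ZMod 2))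
    (hL : ∀ v, (∀ x ∈ dotpPerp L, dotp x v = 0) → v ∈ L)
    (haff : ∀ a, ∀ v ∈ L, ∀ w ∈ L, π (a + (v + w)) = π (a + v) + π (a + w) + π a) :
    IsBent2m (fpl π L) := by
  rintro ⟨a, b⟩
  have hind : ∀ x, signChar (({y : Fin m → ZMod 2 | ∀ x ∈ (L : Set _), dotp x y = 0}).indicator
      (fun _ => (1 : ZMod 2)) x) = 1 - 2 * (if x ∈ dotpPerp L then 1 else 0) := by
    intro x
    by_cases hx : x ∈ dotpPerp L
    · rw [Set.indicator_of_mem (show x ∈ {y | ∀ x ∈ (L : Set _), dotp x y = 0} from hx), if_pos hx]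
      rfl
    · rw [Set.indicator_of_notMem (show x ∉ {y | ∀ x ∈ (L : Set _), dotp x y = 0} from hx),
        if_neg hx]
      rfl
  have hinner : ∀ u, ∑ x, signChar (dotp x (u + a)) * (1 - 2 * (if x ∈ dotpPerp L then 1 else 0)) =
      (if u + a = 0 then 2 ^ m else 0) -
        2 * (if u + a ∈ L then (Fintype.card (dotpPerp L) : ℤ) else 0) := by
    intro u
    have h2 : ∑ x, (if x ∈ dotpPerp L then signChar (dotp x (u + a)) else 0) =
        if u + a ∈ L then (Fintype.card (dotpPerp L) : ℤ) else 0 := by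
      rw [sum_ite_mem_subgroup (dotpPerp L) fun x => signChar (dotp x (u + a)),
        sum_signChar_dotp_subgroup]
      exact if_congr ⟨hL _, fun hv x hx => by rw [dotp_comm]; exact hx _ hv⟩ rfl rfl
    rw [← sum_signChar_dotp, ← h2, Finset.mul_sum, ← Finset.sum_sub_distrib]
    refine Finset.sum_congr rfl fun x _ => ?_
    split_ifs <;> ring
  have hsum : ∑ v : L, signChar (dotp b (π (a + v)) + dotp b (π a)) =
      0 ∨ ∑ v : L, signChar (dotp b (π (a + v)) + dotp b (π a)) = Fintype.card L := by
    have := sum_signChar_addMonoidHom (G := L)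
      { toFun := fun v => dotp b (π (a + v)) + dotp b (π a)
        map_zero' := by simp [CharTwo.add_self_eq_zero]
        map_add' := fun v w => by
          simp only [AddSubgroup.coe_add]
          rw [haff a v v.2 w w.2, dotp_add_right, dotp_add_right]
          ring }
    simp only [AddMonoidHom.coe_mk, ZeroHom.coe_mk] at this
    rw [this]
    split_ifs <;> simp
  have hW : ∑ z : (Fin m → ZMod 2) × (Fin m → ZMod 2),
      (-1 : ℤ) ^ ((fpl π L z + dotp a z.1 + dotp b z.2).val) =
      signChar (dotp b (π a)) * (2 ^ m - 2 * Fintype.card (dotpPerp L) *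
        ∑ v : L, signChar (dotp b (π (a + v)) + dotp b (π a))) := by
    simp_rw [← signChar_apply]
    rw [Fintype.sum_prod_type_right, ← Equiv.sum_comp (hπ.toPerm π)]
    have h3 : ∀ u, ∑ x, signChar (fpl π L (x, π u) + dotp a x + dotp b (π u)) =
        signChar (dotp b (π u)) * ((if u + a = 0 then 2 ^ m else 0) -
        2 * (if u + a ∈ L then (Fintype.card (dotpPerp L) : ℤ) else 0)) := by
      intro u
      rw [← hinner, Finset.mul_sum]
      refine Finset.sum_congr rfl fun x _ => ?_
      rw [← hind, fpl, hπ u, dotp_add_right, dotp_comm a x]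
      simp only [AddChar.map_add_eq_mul]
      ring
    simp only [Function.Involutive.coe_toPerm]
    simp_rw [h3]
    rw [← Equiv.sum_comp (Equiv.addLeft a)]
    have h4 : ∀ v, a + v + a = v := fun v => by
      rw [add_right_comm, pi_zmod_two_add_self, zero_add]
    simp only [Equiv.coe_addLeft, h4, mul_sub, Finset.sum_sub_distrib]
    congr 1
    · simp
    · rw [← sum_ite_mem_subgroup L fun v => signChar (dotp b (π (a + v)) + dotp b (π a)),
        Finset.mul_sum, Finset.mul_sum]
      refine Finset.sum_congr rfl fun v _ => ?_
      split_ifs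
      · rw [AddChar.map_add_eq_mul]
        linear_combination (-2 * signChar (dotp b (π (a + v))) * Fintype.card (dotpPerp L)) *
          signChar_mul_self (dotp b (π a))
      · simp
  have hcard := card_mul_card_dotpPerp L hL
  simp only [hW]
  rcases hsum with h | h <;> rcases signChar_eq_or (dotp b (π a)) with h' | h' <;> rw [h, h']
  · left; ring
  · right; ring
  · right; linear_combination (-2) * hcard
  · left; linear_combination 2 * hcard

/-- The vectors whose first `s` coordinates vanish. -/
def tailSubgroup (m s : ℕ) : AddSubgroup (Fin m → ZMod 2) where
  carrier := {x | ∀ j : Fin m, (j : ℕ) < s → x j = 0}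
  zero_mem' _ _ := rfl
  add_mem' {a b} ha hb j hj := by simp [ha j hj, hb j hj]
  neg_mem' {a} ha j hj := by simp [ha j hj]

theorem mem_tailSubgroup_of_perp {m s : ℕ} (v : Fin m → ZMod 2)
    (hv : ∀ x ∈ dotpPerp (tailSubgroup m s), dotp x v = 0) : v ∈ tailSubgroup m s := by
  intro j hj
  rw [← dotp_single_left j v]
  refine hv _ fun x hx => ?_
  rw [dotp_comm, dotp_single_left]
  exact hx j hj

/-- A polynomial with at most one tail variable per monomial, occurring to the first power,
is affine along the tail subgroup. -/
theorem eval_add_add_of_mem_tailSubgroup {m s : ℕ} (P : MvPolynomial (Fin m) (ZMod 2))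
    (hPml : ∀ d ∈ P.support, ∀ i, (d : (Fin m →₀ ℕ)) i ≤ 1)
    (halpha : ∀ d ∈ P.support,
      ((d : (Fin m →₀ ℕ)).support.filter (fun i : Fin m => s ≤ (i : ℕ))).card ≤ 1)
    (a : Fin m → ZMod 2) {v w : Fin m → ZMod 2}
    (hv : v ∈ tailSubgroup m s) (hw : w ∈ tailSubgroup m s) :
    MvPolynomial.eval (a + (v + w)) P =
      MvPolynomial.eval (a + v) P + MvPolynomial.eval (a + w) P + MvPolynomial.eval a P := by
  simp only [MvPolynomial.eval_eq]
  rw [← Finset.sum_add_distrib, ← Finset.sum_add_distrib]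
  refine Finset.sum_congr rfl fun d hd => ?_
  rw [← mul_add, ← mul_add]
  congr 1
  have hsplit : ∀ u ∈ tailSubgroup m s, ∏ i ∈ d.support, (a + u) i ^ d i =
      (∏ i ∈ d.support with s ≤ (Fin.val i), (a i + u i)) *
        ∏ i ∈ d.support with ¬ s ≤ (Fin.val i), a i ^ d i := by
    intro u hu
    rw [← Finset.prod_filter_mul_prod_filter_not d.support (fun i : Fin m => s ≤ (i : ℕ))]
    congr 1
    · refine Finset.prod_congr rfl fun i hi => ?_
      have h0 : d i ≠ 0 := Finsupp.mem_support_iff.1 (Finset.mem_filter.1 hi).1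
      have h1 : d i = 1 := by have := hPml d hd i; omega
      rw [h1, pow_one, Pi.add_apply]
    · refine Finset.prod_congr rfl fun i hi => ?_
      rw [Pi.add_apply, hu i (not_le.1 (Finset.mem_filter.1 hi).2), add_zero]
  have ha := hsplit 0 (zero_mem _)
  rw [add_zero] at ha
  rw [hsplit v hv, hsplit w hw, hsplit _ (add_mem hv hw), ha, ← add_mul, ← add_mul]
  congr 1
  rcases Nat.le_one_iff_eq_zero_or_eq_one.1 (halpha d hd) with h | h
  · rw [Finset.card_eq_zero.1 h]
    simp only [Finset.prod_empty]
    decide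
  · obtain ⟨i, hi⟩ := Finset.card_eq_one.1 h
    simp only [hi, Finset.prod_singleton, Pi.add_apply, Pi.zero_apply, add_zero]
    exact zmod_two_add_add_add _ _ _

theorem eval_update_of_forall_eq_zero {m : ℕ} (P : MvPolynomial (Fin m) (ZMod 2)) (k : Fin m)
    (hP : ∀ d ∈ P.support, (d : (Fin m →₀ ℕ)) k = 0) (x : Fin m → ZMod 2) (c : ZMod 2) :
    MvPolynomial.eval (Function.update x k c) P = MvPolynomial.eval x P := by
  simp only [MvPolynomial.eval_eq]
  refine Finset.sum_congr rfl fun d hd => ?_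
  congr 1
  refine Finset.prod_congr rfl fun i hi => ?_
  have : i ≠ k := fun h => Finsupp.mem_support_iff.1 hi (h ▸ hP d hd)
  rw [Function.update_of_ne this]

/-- with `L = {(0,…,0,x_{s+1},…,x_m)}`, if the multilinear polynomial `P`
(in `X₂,…,X_m`) has no monomial containing at least two variables `X_i` with `i > s`,
then `f_{(π,L)}` is bent on `𝔽₂^{2m}`, where `π(x) = (x₁ + P(x₂,…,x_m), x₂,…,x_m)`.
(Coordinates are 0-indexed: `x j` is `x_{j+1}`.) -/
theorem stmt_8 (m s : ℕ) [NeZero m] (hm : 2 ≤ m) (hs1 : 1 ≤ s) (hsm : s ≤ m)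
    (P : MvPolynomial (Fin m) (ZMod 2))
    (hP0 : ∀ d ∈ P.support, (d : (Fin m →₀ ℕ)) 0 = 0)
    (hPml : ∀ d ∈ P.support, ∀ i, (d : (Fin m →₀ ℕ)) i ≤ 1)
    (halpha : ∀ d ∈ P.support,
      ((d : (Fin m →₀ ℕ)).support.filter (fun i : Fin m => s ≤ (i : ℕ))).card ≤ 1) :
    IsBent2m (fpl (fun x => Function.update x 0 (x 0 + MvPolynomial.eval x P))
      {x : Fin m → ZMod 2 | ∀ j : Fin m, (j : ℕ) < s → x j = 0}) := by
  refine isBent2m_fpl _ ?_ (tailSubgroup m s) mem_tailSubgroup_of_perp ?_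
  · intro x
    simp only [eval_update_of_forall_eq_zero P 0 hP0, Function.update_self, Function.update_idem,
      add_assoc, CharTwo.add_self_eq_zero, add_zero, Function.update_eq_self]
  · intro a v hv w hw
    have hP := eval_add_add_of_mem_tailSubgroup P hPml halpha a hv hw
    funext i
    rcases eq_or_ne i 0 with rfl | hi
    · simp only [Function.update_self, Pi.add_apply, hP]
      rw [zmod_two_add_add_add (a 0)]
      ring
    · simp only [Function.update_of_ne hi, Pi.add_apply]
      exact zmod_two_add_add_add _ _ _
end

section
/- Let L = {(0,0,x₃,x₄) : x₃,x₄ ∈ 𝔽₂} ⊆ 𝔽₂^4, let α, β, γ, δ ∈ 𝔽₂ with (γ,δ) ≠ (0,0), and let π : 𝔽₂^4 → 𝔽₂^4 be the permutation π(x) = (x₁ + αx₂x₃ + βx₂x₄ + γx₃x₄ + δx₂x₃x₄, x₂, x₃, x₄). Then f_{(π,L)} : 𝔽₂^4 × 𝔽₂^4 → 𝔽₂ is not a bent function. -/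
/-- The orthogonal complement of `{(0,0,x₃,x₄)}` is `{(x₁,x₂,0,0)}`. -/
theorem forall_dotp_eq_zero_iff (y : Fin 4 → ZMod 2) :
    (∀ x ∈ {x : Fin 4 → ZMod 2 | x 0 = 0 ∧ x 1 = 0}, dotp x y = 0) ↔ y 2 = 0 ∧ y 3 = 0 := by
  constructor
  · intro h
    have h₂ := h ![0, 0, 1, 0] (by simp)
    have h₃ := h ![0, 0, 0, 1] (by simp)
    simp [dotp, Fin.sum_univ_four] at h₂ h₃
    exact ⟨h₂, h₃⟩
  · rintro ⟨h₂, h₃⟩ x ⟨h₀, h₁⟩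
    simp [dotp, Fin.sum_univ_four, h₀, h₁, h₂, h₃]

theorem neg_one_pow_val_add (s t : ZMod 2) :
    (-1 : ℤ) ^ (s + t).val = (-1) ^ s.val * (-1) ^ t.val := by
  revert s t
  decide

/-- The Walsh–Hadamard transform of the indicator function of `{(x₁,x₂,0,0)}`. -/
theorem sum_neg_one_pow_dotp_add_indicator : ∀ v : Fin 4 → ZMod 2,
    (∑ x : Fin 4 → ZMod 2, (-1 : ℤ) ^ (dotp x v + if x 2 = 0 ∧ x 3 = 0 then 1 else 0).val) =
      if v 0 = 0 ∧ v 1 = 0 then (if v 2 = 0 ∧ v 3 = 0 then 8 else -8) else 0 := by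
  decide +kernel

theorem sum_apply_update_mem : ∀ α β γ δ c : ZMod 2, γ + δ * c = 1 →
    (∑ y : Fin 4 → ZMod 2,
      (-1 : ℤ) ^ (y 0).val * if y 0 + α * (y 1 * y 2) + β * (y 1 * y 3) + γ * (y 2 * y 3)
            + δ * (y 1 * y 2 * y 3) = 0 ∧ y 1 + c = 0 then
          (if y 2 = 0 ∧ y 3 = 0 then 8 else -8) else 0) ∈ ({0, 32} : Finset ℤ) := by
  decide +kernel

/-- If `γ + δ c = 1`, the Walsh–Hadamard coefficient at `((0,c,0,0), (1,0,0,0))` is `0` or `32`. -/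
theorem walsh_eq_zero_or_eq_thirtyTwo (α β γ δ c : ZMod 2) (hc : γ + δ * c = 1) :
    (∑ z : (Fin 4 → ZMod 2) × (Fin 4 → ZMod 2),
      (-1 : ℤ) ^ ((dotp z.1 (Function.update z.2 0
          (z.2 0 + α * (z.2 1 * z.2 2) + β * (z.2 1 * z.2 3) + γ * (z.2 2 * z.2 3)
            + δ * (z.2 1 * z.2 2 * z.2 3))) + (if z.1 2 = 0 ∧ z.1 3 = 0 then 1 else 0)
        + dotp ![0, c, 0, 0] z.1 + dotp ![1, 0, 0, 0] z.2).val)) ∈ ({0, 32} : Finset ℤ) := by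
  convert sum_apply_update_mem α β γ δ c hc using 1
  rw [Fintype.sum_prod_type_right]
  refine Finset.sum_congr rfl fun y _ => ?_
  refine Eq.trans ?_ (congrArg ((-1 : ℤ) ^ (y 0).val * ·) (sum_neg_one_pow_dotp_add_indicator
    ![y 0 + α * (y 1 * y 2) + β * (y 1 * y 3) + γ * (y 2 * y 3) + δ * (y 1 * y 2 * y 3),
      y 1 + c, y 2, y 3]))
  rw [Finset.mul_sum]
  refine Finset.sum_congr rfl fun x _ => ?_
  rw [← neg_one_pow_val_add]
  congr 2
  simp [dotp, Fin.sum_univ_four]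
  ring

/-- for `L = {(0,0,x₃,x₄)} ⊆ 𝔽₂⁴`, `(γ,δ) ≠ (0,0)`, and
`π(x) = (x₁ + αx₂x₃ + βx₂x₄ + γx₃x₄ + δx₂x₃x₄, x₂, x₃, x₄)`, the function
`f_{(π,L)} : 𝔽₂⁴ × 𝔽₂⁴ → 𝔽₂` is not bent. (Coordinates are 0-indexed.) -/
theorem stmt_15 (α β γ δ : ZMod 2) (h : ¬ (γ = 0 ∧ δ = 0)) :
    ¬ IsBent2m (fpl
      (fun x : Fin 4 → ZMod 2 => Function.update x 0
        (x 0 + α * (x 1 * x 2) + β * (x 1 * x 3) + γ * (x 2 * x 3) + δ * (x 1 * x 2 * x 3)))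
      {x : Fin 4 → ZMod 2 | x 0 = 0 ∧ x 1 = 0}) := by
  classical
  intro hb
  obtain ⟨c, hc⟩ : ∃ c : ZMod 2, γ + δ * c = 1 := by
    clear hb
    revert γ δ
    decide
  have key := walsh_eq_zero_or_eq_thirtyTwo α β γ δ c hc
  have hw := hb (![0, c, 0, 0], ![1, 0, 0, 0])
  simp only [fpl, Set.indicator_apply, forall_dotp_eq_zero_iff] at hw
  simp only [Finset.mem_insert, Finset.mem_singleton] at key
  generalize hS : (∑ z : (Fin 4 → ZMod 2) × (Fin 4 → ZMod 2), _ : ℤ) = S at key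
  have hw' : S = 2 ^ 4 ∨ S = -2 ^ 4 := by
    rw [← hS]
    convert hw <;> rfl
  omega
end
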